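/- (Harsanyi dividend representation) Let v be a coalitional game on the finite player set N with v(∅) = 0, and define the Harsanyi dividends recursively by d_v(∅) = 0 and d_v(S) = v(S) − Σ_{T ⊊ S} d_v(T) for nonempty S ⊆ N. Then for every player i ∈ N, the Shapley value of i equals the sum of the equally divided dividends of all coalitions containing i: φ_i(v) = Σ_{S ⊆ N, i ∈ S} d_v(S)/|S|. -/

import Mathlib

open Finset

/-- The set of players that precede player `i` in the ordering given by the
permutation `O` (player `j` precedes `i` if its position `O.symm j` is smaller). -/
def pre {n : ℕ} (O : Equiv.Perm (Fin n)) (i : Fin n) : Finset (Fin n) :=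
  Finset.univ.filter (fun j => O.symm j < O.symm i)

/-- The Shapley value of player `i` in the coalitional game `v`, expressed as the
average over all permutations of the marginal contribution of `i`. -/
noncomputable def shapleyPerm {n : ℕ} (v : Finset (Fin n) → ℝ) (i : Fin n) : ℝ :=
  (1 / (Nat.factorial n : ℝ)) *
    ∑ O : Equiv.Perm (Fin n), (v (insert i (pre O i)) - v (pre O i))

/-- The Shapley value of player `i` in the coalitional game `v`, expressed as the
weighted sum over all coalitions not containing `i`. -/
noncomputable def shapleySub {n : ℕ} (v : Finset (Fin n) → ℝ) (i : Fin n) : ℝ :=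
  ∑ S ∈ ((Finset.univ : Finset (Fin n)).erase i).powerset,
    (((S.card.factorial : ℝ) * ((n - S.card - 1).factorial : ℝ)) / (n.factorial : ℝ)) *
      (v (insert i S) - v S)

/-- The Harsanyi dividends of the game `v`, defined recursively by
`d_v(S) = v(S) - ∑_{T ⊊ S} d_v(T)` (so that `d_v(∅) = v(∅)`). -/
noncomputable def dividend {n : ℕ} (v : Finset (Fin n) → ℝ) (S : Finset (Fin n)) : ℝ :=
  v S - ∑ T ∈ S.ssubsets.attach, dividend v T.1
termination_by S.card
decreasing_by
  exact Finset.card_lt_card (Finset.mem_ssubsets.mp T.2)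

theorem sum_powerset_dividend {n : ℕ} (v : Finset (Fin n) → ℝ) (S : Finset (Fin n)) :
    ∑ T ∈ S.powerset, dividend v T = v S := by
  have hS := Finset.sum_erase_add S.powerset (dividend v) (Finset.mem_powerset_self S)
  have hd : dividend v S = v S - ∑ T ∈ S.ssubsets, dividend v T := by
    rw [dividend, Finset.sum_attach S.ssubsets (dividend v)]
  rw [← hS, hd, Finset.ssubsets]
  ring

theorem marginal_eq_sum_dividend {n : ℕ} (v : Finset (Fin n) → ℝ) {i : Fin n}
    {S : Finset (Fin n)} (hi : i ∉ S) :
    v (insert i S) - v S = ∑ T ∈ S.powerset, dividend v (insert i T) := by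
  rw [← sum_powerset_dividend v (insert i S), Finset.sum_powerset_insert hi,
    sum_powerset_dividend, add_sub_cancel_left]

theorem sum_powerset_factorial_mul_factorial {α : Type*} [DecidableEq α] (t : ℕ) (U : Finset α) :
    ∑ R ∈ U.powerset, (((t + R.card).factorial : ℝ) * ((U.card - R.card).factorial : ℝ)) /
      ((t + U.card + 1).factorial : ℝ) = 1 / ((t : ℝ) + 1) := by
  induction U using Finset.induction_on with
  | empty =>
    have := Nat.factorial_ne_zero t
    simp [Nat.factorial_succ]
    field_simp
  | insert a U ha ih =>
    rw [Finset.sum_powerset_insert ha, ← Finset.sum_add_distrib, ← ih]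
    refine Finset.sum_congr rfl fun R hR => ?_
    have hRU := Finset.mem_powerset.mp hR
    obtain ⟨k, hk⟩ := Nat.exists_eq_add_of_le (Finset.card_le_card hRU)
    rw [Finset.card_insert_of_notMem ha, Finset.card_insert_of_notMem fun h => ha (hRU h), hk,
      show R.card + k + 1 - R.card = k + 1 by lia,
      show R.card + k + 1 - (R.card + 1) = k by lia, Nat.add_sub_cancel_left,
      show t + (R.card + k + 1) + 1 = (t + (R.card + k) + 1) + 1 by lia,
      ← add_assoc t R.card 1, Nat.factorial_succ (t + (R.card + k) + 1), Nat.factorial_succ k,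
      Nat.factorial_succ (t + R.card)]
    push_cast
    have hpos : (t : ℝ) + (R.card + k) + 1 + 1 ≠ 0 := by positivity
    field_simp
    ring

theorem sum_Icc_factorial_mul_factorial {α : Type*} [DecidableEq α] {T M : Finset α}
    (h : T ⊆ M) :
    ∑ S ∈ Finset.Icc T M, ((S.card.factorial : ℝ) * ((M.card - S.card).factorial : ℝ)) /
      ((M.card + 1).factorial : ℝ) = 1 / ((T.card : ℝ) + 1) := by
  have hdisj : ∀ R ∈ (M \ T).powerset, Disjoint T R := fun R hR =>
    Finset.disjoint_sdiff.mono_right (Finset.mem_powerset.mp hR)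
  rw [← sum_powerset_factorial_mul_factorial T.card (M \ T), Finset.Icc_eq_image_powerset h,
    Finset.sum_image]
  · refine Finset.sum_congr rfl fun R hR => ?_
    have hM := Finset.card_sdiff_add_card_eq_card h
    rw [Finset.card_union_of_disjoint (hdisj R hR), ← hM,
      show (M \ T).card + T.card - (T.card + R.card) = (M \ T).card - R.card by lia,
      add_comm (M \ T).card T.card]
  · intro R hR R' hR' hRR'
    replace hRR' : T ∪ R = T ∪ R' := hRR'
    rw [← Finset.union_sdiff_cancel_left (hdisj R hR), hRR',
      Finset.union_sdiff_cancel_left (hdisj R' hR')]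

/-- Harsanyi dividend representation: the Shapley value of player `i`
is the sum of the equally divided dividends of all coalitions containing `i`. -/
theorem shapley_eq_sum_dividends {n : ℕ} (v : Finset (Fin n) → ℝ) (hv : v ∅ = 0)
    (i : Fin n) :
    shapleySub v i =
      ∑ S ∈ (Finset.univ : Finset (Fin n)).powerset.filter (fun S => i ∈ S),
        dividend v S / (S.card : ℝ) := by
  set M := (Finset.univ : Finset (Fin n)).erase i with hMdef
  have hiM : i ∉ M := Finset.notMem_erase i _
  have hM : M.card + 1 = n := by
    rw [hMdef, Finset.card_erase_add_one (Finset.mem_univ i), Finset.card_fin]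
  have hrhs : ∑ S ∈ (Finset.univ : Finset (Fin n)).powerset.filter (fun S => i ∈ S),
      dividend v S / (S.card : ℝ) =
      ∑ T ∈ M.powerset, dividend v (insert i T) / ((T.card : ℝ) + 1) := by
    rw [Finset.sum_filter, ← Finset.insert_erase (Finset.mem_univ i), ← hMdef,
      Finset.sum_powerset_insert hiM, Finset.sum_eq_zero, zero_add]
    · refine Finset.sum_congr rfl fun T hT => ?_
      rw [if_pos (Finset.mem_insert_self i T),
        Finset.card_insert_of_notMem fun h => hiM (Finset.mem_powerset.mp hT h), Nat.cast_succ]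
    · exact fun T hT => if_neg fun h => hiM (Finset.mem_powerset.mp hT h)
  have hlhs : shapleySub v i = ∑ S ∈ M.powerset, ∑ T ∈ S.powerset,
      ((S.card.factorial : ℝ) * ((M.card - S.card).factorial : ℝ)) /
        ((M.card + 1).factorial : ℝ) * dividend v (insert i T) := by
    refine Finset.sum_congr rfl fun S hS => ?_
    rw [marginal_eq_sum_dividend v fun h => hiM (Finset.mem_powerset.mp hS h), Finset.mul_sum, hM,
      show n - S.card - 1 = M.card - S.card by lia]
  rw [hrhs, hlhs, Finset.sum_comm' (t' := M.powerset) (s' := fun T => Finset.Icc T M)]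
  · refine Finset.sum_congr rfl fun T hT => ?_
    rw [← Finset.sum_mul, sum_Icc_factorial_mul_factorial (Finset.mem_powerset.mp hT)]
    ring
  · intro S T
    simp only [Finset.mem_powerset, Finset.mem_Icc]
    exact ⟨fun h => ⟨⟨h.2, h.1⟩, h.2.trans h.1⟩, fun h => ⟨h.1.2, h.1.1⟩⟩
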